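/- Let N ≥ 2, let Ω ⊂ ℝ^N be a bounded domain with C³ boundary and unit volume, and let p ∈ (1, p_N). Then λ_*(Ω, p) > λ₀(Ω, p), where λ₀(Ω, p) = Λ(Ω, 2p)/p; in particular, for every λ with 0 ≤ λ ≤ λ₀(Ω, p) and every solution (α, ψ) of (P)_λ on Ω, every eigenvalue of the linearized operator L_λ at (α, ψ) is strictly positive. -/

import Mathlib

open MeasureTheory Metric Set

noncomputable section

/-- The Laplacian of a function on Euclidean space. -/
def lapl {N : ℕ} (f : EuclideanSpace ℝ (Fin N) → ℝ) (x : EuclideanSpace ℝ (Fin N)) : ℝ :=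
  ∑ i : Fin N,
    fderiv ℝ (fun y => fderiv ℝ f y (EuclideanSpace.single i (1 : ℝ))) x
      (EuclideanSpace.single i (1 : ℝ))

/-- `(α, ψ)` is a solution of problem `(P)_λ` on `Ω`:
`ψ ∈ C²`, `-Δψ = (max (α + λψ) 0)^p` in `Ω`, `ψ = 0` on `∂Ω`, and
`∫_Ω (max (α + λψ) 0)^p = 1`. -/
def IsSol {N : ℕ} (Ω : Set (EuclideanSpace ℝ (Fin N))) (p lam α : ℝ)
    (ψ : EuclideanSpace ℝ (Fin N) → ℝ) : Prop :=
  ContDiff ℝ 2 ψ ∧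
  (∀ x ∈ Ω, -lapl ψ x = (max (α + lam * ψ x) 0) ^ p) ∧
  (∀ x ∈ frontier Ω, ψ x = 0) ∧
  (∫ x in Ω, (max (α + lam * ψ x) 0) ^ p) = 1

/-- The weight `V = (max (α + λψ) 0)^(p-1)`. -/
def Vfun {N : ℕ} (p lam α : ℝ) (ψ : EuclideanSpace ℝ (Fin N) → ℝ)
    (x : EuclideanSpace ℝ (Fin N)) : ℝ :=
  (max (α + lam * ψ x) 0) ^ (p - 1)

/-- `m = ∫_Ω V`. -/
def mV {N : ℕ} (Ω : Set (EuclideanSpace ℝ (Fin N))) (p lam α : ℝ)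
    (ψ : EuclideanSpace ℝ (Fin N) → ℝ) : ℝ :=
  ∫ x in Ω, Vfun p lam α ψ x

/-- The weighted average `⟨φ⟩ = (∫_Ω V φ) / m`. -/
def avgV {N : ℕ} (Ω : Set (EuclideanSpace ℝ (Fin N))) (p lam α : ℝ)
    (ψ φ : EuclideanSpace ℝ (Fin N) → ℝ) : ℝ :=
  (∫ x in Ω, Vfun p lam α ψ x * φ x) / mV Ω p lam α ψ

/-- `σ` is an eigenvalue of the linearized operator `L_λ` at the solution `(α, ψ)`:
there is a nontrivial `φ ∈ C²(Ω̄)` vanishing on `∂Ω` with `-Δφ = (pλ + σ) V [φ]` in `Ω`. -/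
def IsEigen {N : ℕ} (Ω : Set (EuclideanSpace ℝ (Fin N))) (p lam α : ℝ)
    (ψ : EuclideanSpace ℝ (Fin N) → ℝ) (σ : ℝ) : Prop :=
  ∃ φ : EuclideanSpace ℝ (Fin N) → ℝ, ContDiff ℝ 2 φ ∧
    (∃ x ∈ closure Ω, φ x ≠ 0) ∧ (∀ x ∈ frontier Ω, φ x = 0) ∧
    ∀ x ∈ Ω, -lapl φ x = (p * lam + σ) * (Vfun p lam α ψ x * (φ x - avgV Ω p lam α ψ φ))

/-- `Ω` is a bounded domain of class `C³`: open, connected, bounded, and near every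
boundary point `Ω` is the sublevel set of a `C³` function with nonvanishing gradient. -/
def IsC3Domain {N : ℕ} (Ω : Set (EuclideanSpace ℝ (Fin N))) : Prop :=
  IsOpen Ω ∧ IsConnected Ω ∧ Bornology.IsBounded Ω ∧
  ∀ x ∈ frontier Ω, ∃ (U : Set (EuclideanSpace ℝ (Fin N)))
      (f : EuclideanSpace ℝ (Fin N) → ℝ),
    IsOpen U ∧ x ∈ U ∧ ContDiff ℝ 3 f ∧ (∀ y ∈ U, fderiv ℝ f y ≠ 0) ∧
    Ω ∩ U = {y ∈ U | f y < 0}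

/-- `Λ(Ω, t)`: the infimum of `(∫_Ω ‖∇w‖²) / (∫_Ω |w|^t)^(2/t)` over nonzero smooth
compactly supported `w` with support contained in `Ω`. -/
def Lam {N : ℕ} (Ω : Set (EuclideanSpace ℝ (Fin N))) (t : ℝ) : ℝ :=
  sInf {r : ℝ | ∃ w : EuclideanSpace ℝ (Fin N) → ℝ, ContDiff ℝ (⊤ : ℕ∞) w ∧
    HasCompactSupport w ∧ tsupport w ⊆ Ω ∧ w ≠ 0 ∧
    r = (∫ x in Ω, ‖gradient w x‖ ^ 2) / (∫ x in Ω, |w x| ^ t) ^ (2 / t)}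

open scoped NNReal ENNReal

theorem norm_gradient_eq_norm_fderiv {N : ℕ} (w : EuclideanSpace ℝ (Fin N) → ℝ)
    (x : EuclideanSpace ℝ (Fin N)) : ‖gradient w x‖ = ‖fderiv ℝ w x‖ := by
  simp [gradient]

/-- Subcritical Sobolev inequality for `C¹` functions supported in a domain of unit volume. -/
theorem exists_sobolev_const {N : ℕ} (hN : 2 ≤ N) {Ω : Set (EuclideanSpace ℝ (Fin N))}
    (hb : Bornology.IsBounded Ω) (hvol : volume Ω = 1) {q : ℝ} (hq : 0 < q)
    (hqN : 1 / 2 < 1 / q + 1 / (N : ℝ)) :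
    ∃ S : ℝ, 0 < S ∧ ∀ w : EuclideanSpace ℝ (Fin N) → ℝ, ContDiff ℝ 1 w → HasCompactSupport w →
      tsupport w ⊆ Ω →
      S * (∫ x in Ω, |w x| ^ q) ^ (2 / q) ≤ ∫ x in Ω, ‖gradient w x‖ ^ 2 := by
  obtain ⟨t, ht1, ht2, htq⟩ : ∃ t : ℝ≥0, 1 ≤ t ∧ t < 2 ∧ ((t : ℝ)⁻¹ ≤ 1 / q + 1 / (N : ℝ)) := by
    have hm : (1 / 2 : ℝ) < min 1 (1 / q + 1 / (N : ℝ)) := lt_min (by norm_num) hqN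
    have hm0 : (0 : ℝ) < min 1 (1 / q + 1 / (N : ℝ)) := lt_trans (by norm_num) hm
    have hc : (((min 1 (1 / q + 1 / (N : ℝ)))⁻¹.toNNReal : ℝ≥0) : ℝ)
        = (min 1 (1 / q + 1 / (N : ℝ)))⁻¹ := Real.coe_toNNReal _ (by positivity)
    refine ⟨(min 1 (1 / q + 1 / (N : ℝ)))⁻¹.toNNReal, ?_, ?_, ?_⟩
    · rw [← NNReal.coe_le_coe, hc]
      exact (one_le_inv₀ hm0).2 (min_le_left _ _)
    · rw [← NNReal.coe_lt_coe, hc]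
      have := inv_strictAnti₀ (by norm_num) hm
      simpa using this
    · rw [hc, inv_inv]
      exact min_le_right _ _
  have hNR : (2 : ℝ≥0) ≤ N := by exact_mod_cast hN
  obtain ⟨q', hq'⟩ : ∃ q' : ℝ≥0, (q' : ℝ) = q := ⟨q.toNNReal, Real.coe_toNNReal _ hq.le⟩
  have hq'0 : q' ≠ 0 := by
    rintro rfl
    exact hq.ne' (by simpa using hq'.symm)
  have : IsProbabilityMeasure (volume.restrict Ω) := ⟨by simp [hvol]⟩
  set C : ℝ≥0 := eLpNormLESNormFDerivOfLeConst ℝ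
    (volume : Measure (EuclideanSpace ℝ (Fin N))) Ω t q' with hC
  refine ⟨(((C : ℝ) + 1) ^ 2)⁻¹, by positivity, fun w hw hcw hwΩ => ?_⟩
  have hsub : Function.support w ⊆ Ω := (subset_tsupport w).trans hwΩ
  have hsub' : Function.support (fderiv ℝ w) ⊆ Ω := (support_fderiv_subset ℝ).trans hwΩ
  have hcont : Continuous (fderiv ℝ w) := hw.continuous_fderiv (by norm_num)
  have hD : HasCompactSupport (fderiv ℝ w) := hcw.fderiv ℝ
  have h1 : eLpNorm w q' (volume.restrict Ω)
      ≤ C * eLpNorm (fderiv ℝ w) 2 (volume.restrict Ω) := by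
    rw [eLpNorm_restrict_eq_of_support_subset hsub]
    refine (eLpNorm_le_eLpNorm_fderiv_of_le (F := ℝ) volume hw hsub ht1 ?_ ?_ hb).trans ?_
    · simpa using lt_of_lt_of_le ht2 hNR
    · simp only [finrank_euclideanSpace, Fintype.card_fin]
      have : ((q' : ℝ))⁻¹ = 1 / q := by simp [hq']
      rw [this, sub_le_iff_le_add, ← one_div (N : ℝ)]
      exact htq
    · gcongr
      have hr : eLpNorm (fderiv ℝ w) t (volume.restrict Ω) = eLpNorm (fderiv ℝ w) t volume := by
        rw [← eLpNorm_norm, ← eLpNorm_norm (fderiv ℝ w)]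
        refine eLpNorm_restrict_eq_of_support_subset (fun x hx => hsub' fun h => hx ?_)
        simp [h]
      rw [← hr]
      refine eLpNorm_le_eLpNorm_of_exponent_le ?_ hcont.aestronglyMeasurable
      exact_mod_cast ht2.le
  have hm2 : MemLp (fderiv ℝ w) 2 (volume.restrict Ω) :=
    (hcont.memLp_of_hasCompactSupport hD).restrict _
  have hmq : MemLp w q' (volume.restrict Ω) :=
    (hw.continuous.memLp_of_hasCompactSupport hcw).restrict _
  have h2 : lpNorm w q' (volume.restrict Ω) ≤ C * lpNorm (fderiv ℝ w) 2 (volume.restrict Ω) := by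
    rw [← toReal_eLpNorm hmq.1, ← toReal_eLpNorm hm2.1, ← ENNReal.coe_toReal C,
      ← ENNReal.toReal_mul]
    exact ENNReal.toReal_mono (ENNReal.mul_ne_top ENNReal.coe_ne_top hm2.2.ne) h1
  have e2 : lpNorm (fderiv ℝ w) 2 (volume.restrict Ω) ^ 2 = ∫ x in Ω, ‖gradient w x‖ ^ 2 := by
    have := lpNorm_nnreal_eq_integral_norm_rpow (p := 2) two_ne_zero hm2.1
    simp only [ENNReal.coe_ofNat] at this
    rw [this, ← Real.rpow_natCast, ← Real.rpow_mul (by positivity)]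
    simp [norm_gradient_eq_norm_fderiv]
  have eq : lpNorm w q' (volume.restrict Ω) ^ 2 = (∫ x in Ω, |w x| ^ q) ^ (2 / q) := by
    rw [lpNorm_nnreal_eq_integral_norm_rpow hq'0 hmq.1, ← Real.rpow_natCast,
      ← Real.rpow_mul (by positivity)]
    simp only [Real.norm_eq_abs, hq']
    congr 1
    push_cast
    ring
  rw [← eq, ← e2, inv_mul_le_iff₀ (by positivity), ← mul_pow]
  have hp0 : 0 ≤ lpNorm (fderiv ℝ w) 2 (volume.restrict Ω) := lpNorm_nonneg
  refine pow_le_pow_left₀ lpNorm_nonneg (h2.trans ?_) 2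
  nlinarith

open scoped Convolution in
theorem exists_pos_forall_dist_normed_convolution_le {E F : Type*} [NormedAddCommGroup E]
    [NormedSpace ℝ E] [FiniteDimensional ℝ E] [MeasurableSpace E] [BorelSpace E]
    [NormedAddCommGroup F] [NormedSpace ℝ F] [CompleteSpace F]
    (μ : Measure E) [μ.IsAddHaarMeasure] {g : E → F} (hg : Continuous g) (hc : HasCompactSupport g)
    {ε : ℝ} (hε : 0 < ε) :
    ∃ δ > 0, ∀ b : ContDiffBump (0 : E), b.rOut < δ →
      ∀ x, dist ((b.normed μ ⋆[ContinuousLinearMap.lsmul ℝ ℝ, μ] g) x) (g x) ≤ ε := by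
  obtain ⟨δ, hδ, h⟩ := Metric.uniformContinuous_iff.1
    (hg.uniformContinuous_of_tendsto_cocompact hc.is_zero_at_infty) ε hε
  refine ⟨δ, hδ, fun b hb x => ?_⟩
  exact b.dist_normed_convolution_le hg.aestronglyMeasurable
    fun y hy => (h (lt_trans (mem_ball.1 hy) hb)).le

theorem tendsto_integral_abs_rpow_of_bounded {X : Type*} [MeasurableSpace X] {μ : Measure X}
    [IsFiniteMeasure μ] {h : X → ℝ} {u : ℕ → X → ℝ} (hu : ∀ n, AEStronglyMeasurable (u n) μ)
    {C : ℝ} (hC : ∀ n, ∀ᵐ x ∂μ, |u n x| ≤ C)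
    (hlim : ∀ᵐ x ∂μ, Filter.Tendsto (fun n => u n x) Filter.atTop (nhds (h x)))
    {t : ℝ} (ht : 0 ≤ t) :
    Filter.Tendsto (fun n => ∫ x, |u n x| ^ t ∂μ) Filter.atTop (nhds (∫ x, |h x| ^ t ∂μ)) := by
  have hcont : Continuous fun s : ℝ => |s| ^ t :=
    (Real.continuous_rpow_const ht).comp continuous_abs
  refine tendsto_integral_of_dominated_convergence (fun _ => C ^ t)
    (fun n => hcont.comp_aestronglyMeasurable (hu n)) (integrable_const _) (fun n => ?_) ?_
  · filter_upwards [hC n] with x hx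
    rw [Real.norm_of_nonneg (by positivity)]
    exact Real.rpow_le_rpow (abs_nonneg _) hx ht
  · filter_upwards [hlim] with x hx
    exact (hcont.tendsto _).comp hx

open scoped Convolution in
theorem fderiv_normed_convolution {E : Type*} [NormedAddCommGroup E]
    [NormedSpace ℝ E] [FiniteDimensional ℝ E] [MeasurableSpace E] [BorelSpace E]
    (μ : Measure E) [μ.IsAddHaarMeasure] (b : ContDiffBump (0 : E)) {w : E → ℝ}
    (hw : ContDiff ℝ 1 w) (hcw : HasCompactSupport w) (x : E) :
    fderiv ℝ (b.normed μ ⋆[ContinuousLinearMap.lsmul ℝ ℝ, μ] w) x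
      = (b.normed μ ⋆[ContinuousLinearMap.lsmul ℝ ℝ, μ] (fderiv ℝ w)) x := by
  have := hcw.hasFDerivAt_convolution_right (μ := μ) (ContinuousLinearMap.lsmul ℝ ℝ)
    (b.continuous_normed (μ := μ)).locallyIntegrable hw x
  rw [this.fderiv]
  simp only [convolution]
  congr 1

open scoped Convolution in
theorem exists_smooth_approx {E : Type*} [NormedAddCommGroup E]
    [NormedSpace ℝ E] [FiniteDimensional ℝ E] [MeasurableSpace E] [BorelSpace E]
    (μ : Measure E) [μ.IsAddHaarMeasure] {Ω : Set E} (ho : IsOpen Ω) {w : E → ℝ}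
    (hw : ContDiff ℝ 1 w) (hcw : HasCompactSupport w) (hwΩ : tsupport w ⊆ Ω) :
    ∃ (W : ℕ → E → ℝ) (C : ℝ),
      (∀ n, ContDiff ℝ (⊤ : ℕ∞) (W n) ∧ HasCompactSupport (W n) ∧ tsupport (W n) ⊆ Ω) ∧
      (∀ n x, |W n x| ≤ C ∧ ‖fderiv ℝ (W n) x‖ ≤ C) ∧
      ∀ x, Filter.Tendsto (fun n => W n x) Filter.atTop (nhds (w x)) ∧
        Filter.Tendsto (fun n => fderiv ℝ (W n) x) Filter.atTop (nhds (fderiv ℝ w x)) := by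
  have hcont : Continuous (fderiv ℝ w) := hw.continuous_fderiv (by norm_num)
  have hD : HasCompactSupport (fderiv ℝ w) := hcw.fderiv ℝ
  obtain ⟨r, hr, hrΩ⟩ := hcw.isCompact.exists_cthickening_subset_open ho hwΩ
  obtain ⟨δ₁, hδ₁, h₁⟩ := exists_pos_forall_dist_normed_convolution_le μ hw.continuous hcw
    one_pos
  obtain ⟨δ₂, hδ₂, h₂⟩ := exists_pos_forall_dist_normed_convolution_le μ hcont hD
    one_pos
  obtain ⟨C₁, hC₁⟩ := hw.continuous.bounded_above_of_compact_support hcw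
  obtain ⟨C₂, hC₂⟩ := hcont.bounded_above_of_compact_support hD
  obtain ⟨b, hb, hbr, hb₁, hb₂⟩ : ∃ b : ℕ → ContDiffBump (0 : E),
      Filter.Tendsto (fun n => (b n).rOut) Filter.atTop (nhds 0) ∧
      (∀ n, (b n).rOut < r) ∧ (∀ n, (b n).rOut < δ₁) ∧ ∀ n, (b n).rOut < δ₂ := by
    have hm : 0 < min r (min δ₁ δ₂) / 2 := by positivity
    have hlt : ∀ n : ℕ, min r (min δ₁ δ₂) / 2 * (1 / ((n : ℝ) + 1)) < min r (min δ₁ δ₂) := by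
      intro n
      have h1 : 1 / ((n : ℝ) + 1) ≤ 1 := by
        rw [div_le_one (by positivity)]
        linarith [Nat.cast_nonneg (α := ℝ) n]
      nlinarith
    refine ⟨fun n => ⟨min r (min δ₁ δ₂) / 2 * (1 / ((n : ℝ) + 1)) / 2,
      min r (min δ₁ δ₂) / 2 * (1 / ((n : ℝ) + 1)), by positivity, half_lt_self (by positivity)⟩,
      ?_, fun n => (hlt n).trans_le (min_le_left _ _),
      fun n => (hlt n).trans_le ((min_le_right _ _).trans (min_le_left _ _)),
      fun n => (hlt n).trans_le ((min_le_right _ _).trans (min_le_right _ _))⟩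
    simpa using (tendsto_one_div_add_atTop_nhds_zero_nat (𝕜 := ℝ)).const_mul
      (min r (min δ₁ δ₂) / 2)
  refine ⟨fun n => (b n).normed μ ⋆[ContinuousLinearMap.lsmul ℝ ℝ, μ] w, max (C₁ + 1) (C₂ + 1),
    fun n => ⟨?_, ?_, ?_⟩, fun n x => ⟨?_, ?_⟩, fun x => ⟨?_, ?_⟩⟩
  · exact (b n).hasCompactSupport_normed.contDiff_convolution_left (μ := μ)
      (ContinuousLinearMap.lsmul ℝ ℝ) (b n).contDiff_normed hw.continuous.locallyIntegrable
  · exact (b n).hasCompactSupport_normed.convolution (ContinuousLinearMap.lsmul ℝ ℝ) hcw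
  · refine (closure_minimal ?_ isClosed_cthickening).trans hrΩ
    refine (support_convolution_subset (ContinuousLinearMap.lsmul ℝ ℝ)).trans ?_
    rintro x ⟨z, hz, y, hy, rfl⟩
    rw [(b n).support_normed_eq] at hz
    refine mem_cthickening_of_dist_le _ y _ _ (subset_tsupport _ hy) ?_
    simp only [mem_ball, dist_zero_right] at hz
    simpa using (hz.trans (hbr n)).le
  · have h := h₁ (b n) (hb₁ n) x
    have h' := hC₁ x
    rw [Real.dist_eq] at h
    rw [Real.norm_eq_abs] at h'
    refine le_trans ?_ (le_max_left _ _)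
    linarith [abs_sub_abs_le_abs_sub
      (((b n).normed μ ⋆[ContinuousLinearMap.lsmul ℝ ℝ, μ] w) x) (w x)]
  · have h := h₂ (b n) (hb₂ n) x
    rw [← fderiv_normed_convolution μ (b n) hw hcw x, dist_eq_norm] at h
    refine le_trans ?_ (le_max_right _ _)
    linarith [norm_sub_norm_le
      (fderiv ℝ ((b n).normed μ ⋆[ContinuousLinearMap.lsmul ℝ ℝ, μ] w) x) (fderiv ℝ w x), hC₂ x]
  · exact ContDiffBump.convolution_tendsto_right_of_continuous hb hw.continuous x
  · simp only [fderiv_normed_convolution μ _ hw hcw]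
    exact ContDiffBump.convolution_tendsto_right_of_continuous hb hcont x

/-- The inequality defining `Lam` extends from smooth to `C¹` functions. -/
theorem Lam_mul_le {N : ℕ} {Ω : Set (EuclideanSpace ℝ (Fin N))} (ho : IsOpen Ω)
    (hvol : volume Ω = 1) {t : ℝ} (ht : 0 < t)
    {w : EuclideanSpace ℝ (Fin N) → ℝ} (hw : ContDiff ℝ 1 w) (hcw : HasCompactSupport w)
    (hwΩ : tsupport w ⊆ Ω) :
    Lam Ω t * (∫ x in Ω, |w x| ^ t) ^ (2 / t) ≤ ∫ x in Ω, ‖gradient w x‖ ^ 2 := by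
  have : IsProbabilityMeasure (volume.restrict Ω) := ⟨by simp [hvol]⟩
  obtain ⟨W, C, hWs, hWC, hlim⟩ := exists_smooth_approx volume ho hw hcw hwΩ
  have hW := tendsto_integral_abs_rpow_of_bounded (μ := volume.restrict Ω)
    (fun n => (hWs n).1.continuous.aestronglyMeasurable) (fun n => .of_forall fun x => (hWC n x).1)
    (.of_forall fun x => (hlim x).1) ht.le
  have hG : Filter.Tendsto (fun n => ∫ x in Ω, ‖gradient (W n) x‖ ^ 2) Filter.atTop
      (nhds (∫ x in Ω, ‖gradient w x‖ ^ 2)) := by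
    have := tendsto_integral_abs_rpow_of_bounded (μ := volume.restrict Ω) (C := C)
      (h := fun x => ‖fderiv ℝ w x‖) (u := fun n x => ‖fderiv ℝ (W n) x‖) (t := 2)
      (fun n => ((hWs n).1.continuous_fderiv (by simp)).norm.aestronglyMeasurable)
      (fun n => .of_forall fun x => by simpa using (hWC n x).2)
      (.of_forall fun x => (hlim x).2.norm) zero_le_two
    simpa [norm_gradient_eq_norm_fderiv] using this
  have hpow : Filter.Tendsto (fun n => Lam Ω t * (∫ x in Ω, |W n x| ^ t) ^ (2 / t))
      Filter.atTop (nhds (Lam Ω t * (∫ x in Ω, |w x| ^ t) ^ (2 / t))) :=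
    (((Real.continuous_rpow_const (by positivity)).tendsto _).comp hW).const_mul _
  refine le_of_tendsto_of_tendsto' hpow hG fun n => ?_
  have hnn : 0 ≤ (∫ x in Ω, |W n x| ^ t) ^ (2 / t) := by positivity
  rcases hnn.eq_or_lt with h0 | h0
  · rw [← h0, mul_zero]
    positivity
  · refine (le_div_iff₀ h0).1 (csInf_le ⟨0, ?_⟩ ⟨W n, (hWs n).1, (hWs n).2.1, (hWs n).2.2, ?_, rfl⟩)
    · rintro _ ⟨v, -, -, -, -, rfl⟩
      positivity
    · intro h
      simp [h, Real.zero_rpow ht.ne', Real.zero_rpow (div_pos two_pos ht).ne'] at h0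

theorem Continuous.exists_abs_le_of_isBounded {E : Type*} [MetricSpace E] [ProperSpace E]
    {f : E → ℝ} (hf : Continuous f) {s : Set E} (hs : Bornology.IsBounded s) :
    ∃ C, 0 ≤ C ∧ ∀ x ∈ s, |f x| ≤ C := by
  obtain ⟨C, hC⟩ := hs.isCompact_closure.exists_bound_of_continuousOn hf.continuousOn
  exact ⟨max C 0, le_max_right _ _, fun x hx => (hC x (subset_closure hx)).trans (le_max_left _ _)⟩

theorem Continuous.integrableOn_of_isBounded {E : Type*} [MetricSpace E] [ProperSpace E]
    [MeasurableSpace E] [OpensMeasurableSpace E] {μ : Measure E} [IsFiniteMeasureOnCompacts μ]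
    {f : E → ℝ} (hf : Continuous f) {s : Set E}
    (hs : Bornology.IsBounded s) : IntegrableOn f s μ :=
  (hf.continuousOn.integrableOn_compact hs.isCompact_closure).mono_set subset_closure

theorem exists_posPart_cutoff {δ : ℝ} (hδ : 0 < δ) :
    ∃ η : ℝ → ℝ, ContDiff ℝ 1 η ∧ (∀ s, 0 ≤ deriv η s ∧ deriv η s ≤ 1) ∧
      (∀ s ≤ δ, η s = 0) ∧ ∀ s, |η s - max s 0| ≤ 2 * δ := by
  set T : ℝ → ℝ := fun u => Real.smoothTransition (u / δ - 1) with hT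
  have hTc : Continuous T := Real.smoothTransition.continuous.comp (by fun_prop)
  have hd : ∀ s, HasDerivAt (fun s => ∫ u in (0 : ℝ)..s, T u) (T s) s := fun s =>
    (hTc.integral_hasStrictDerivAt 0 s).hasDerivAt
  have hderiv : deriv (fun s => ∫ u in (0 : ℝ)..s, T u) = T := funext fun s => (hd s).deriv
  have h0 : ∀ s ≤ δ, ∫ u in (0 : ℝ)..s, T u = 0 := fun s hs => by
    rw [intervalIntegral.integral_congr (g := fun _ => 0), intervalIntegral.integral_zero]
    intro u hu
    refine Real.smoothTransition.zero_of_nonpos ?_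
    have : u ≤ δ := (Set.mem_uIcc.1 hu).elim (fun h => h.2.trans hs) (fun h => h.2.trans hδ.le)
    rw [sub_nonpos, div_le_one hδ]
    exact this
  have hb : ∀ s, 0 ≤ s → 0 ≤ ∫ u in (0 : ℝ)..s, T u ∧ ∫ u in (0 : ℝ)..s, T u ≤ s := fun s hs => by
    refine ⟨intervalIntegral.integral_nonneg hs fun u _ => Real.smoothTransition.nonneg _, ?_⟩
    have := intervalIntegral.integral_mono_on hs (hTc.intervalIntegrable 0 s)
      (continuous_const.intervalIntegrable (μ := volume) 0 s)
      (fun u _ => Real.smoothTransition.le_one (u / δ - 1))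
    simpa using this
  refine ⟨fun s => ∫ u in (0 : ℝ)..s, T u, ?_, fun s => ?_, h0, fun s => ?_⟩
  · rw [contDiff_one_iff_deriv, hderiv]
    exact ⟨fun s => (hd s).differentiableAt, hTc⟩
  · rw [hderiv]
    exact ⟨Real.smoothTransition.nonneg _, Real.smoothTransition.le_one _⟩
  · change |(∫ u in (0 : ℝ)..s, T u) - max s 0| ≤ 2 * δ
    rcases le_total s 0 with hs | hs
    · rw [h0 s (hs.trans hδ.le), max_eq_right hs]
      simp [hδ.le]
    · rw [max_eq_left hs]
      have h1 := hb s hs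
      rcases le_total s (2 * δ) with h2 | h2
      · rw [abs_le]
        constructor <;> linarith
      · have h3 := intervalIntegral.integral_add_adjacent_intervals
          (hTc.intervalIntegrable (μ := volume) 0 (2 * δ))
          (hTc.intervalIntegrable (μ := volume) (2 * δ) s)
        have h4 : ∫ u in (2 * δ)..s, T u = s - 2 * δ := by
          rw [intervalIntegral.integral_congr (g := fun _ => 1)]
          · simp
          · intro u hu
            rw [Set.uIcc_of_le h2] at hu
            refine Real.smoothTransition.one_of_one_le ?_
            rw [le_sub_iff_add_le, le_div_iff₀ hδ]
            linarith [hu.1]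
        have h5 := (hb (2 * δ) (by linarith)).1
        rw [abs_le]
        constructor <;> linarith

theorem sum_fderiv_single_sq {N : ℕ} (w : EuclideanSpace ℝ (Fin N) → ℝ)
    (x : EuclideanSpace ℝ (Fin N)) :
    ‖gradient w x‖ ^ 2 = ∑ i, (fderiv ℝ w x (EuclideanSpace.single i (1 : ℝ))) ^ 2 := by
  rw [EuclideanSpace.real_norm_sq_eq]
  refine Finset.sum_congr rfl fun i _ => ?_
  have h : inner ℝ (gradient w x) (EuclideanSpace.single i (1 : ℝ))
      = fderiv ℝ w x (EuclideanSpace.single i (1 : ℝ)) := by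
    simp [gradient]
  rw [← h, EuclideanSpace.inner_single_right]
  simp

theorem contDiff_fderiv_apply {N : ℕ} {φ : EuclideanSpace ℝ (Fin N) → ℝ}
    (hφ : ContDiff ℝ 2 φ) (v : EuclideanSpace ℝ (Fin N)) :
    ContDiff ℝ 1 (fun y => fderiv ℝ φ y v) :=
  (hφ.fderiv_right (m := 1) (by norm_num)).clm_apply contDiff_const

theorem continuous_lapl {N : ℕ} {φ : EuclideanSpace ℝ (Fin N) → ℝ} (hφ : ContDiff ℝ 2 φ) :
    Continuous (lapl φ) := by
  refine continuous_finsetSum _ fun i _ => ?_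
  exact ((contDiff_fderiv_apply hφ _).continuous_fderiv (by norm_num)).clm_apply
    continuous_const

/-- Green's first identity without boundary term. -/
theorem integral_sum_fderiv_mul_fderiv {N : ℕ} {w φ : EuclideanSpace ℝ (Fin N) → ℝ}
    (hw : ContDiff ℝ 1 w) (hcw : HasCompactSupport w) (hφ : ContDiff ℝ 2 φ) :
    ∫ x, ∑ i, fderiv ℝ w x (EuclideanSpace.single i (1 : ℝ))
        * fderiv ℝ φ x (EuclideanSpace.single i (1 : ℝ))
      = ∫ x, -lapl φ x * w x := by
  have hwc : ∀ v, Continuous fun x => fderiv ℝ w x v := fun v =>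
    (hw.continuous_fderiv (by norm_num)).clm_apply continuous_const
  have hwd : ∀ v, HasCompactSupport fun x => fderiv ℝ w x v := fun v => hcw.fderiv_apply ℝ v
  have hg := fun v => contDiff_fderiv_apply hφ v
  have hgd : ∀ v, Continuous fun x => fderiv ℝ (fun y => fderiv ℝ φ y v) x v := fun v =>
    ((hg v).continuous_fderiv (by norm_num)).clm_apply continuous_const
  have h1 : ∀ v, Integrable fun x => fderiv ℝ w x v * fderiv ℝ φ x v := fun v =>
    ((hwc v).mul (hg v).continuous).integrable_of_hasCompactSupport (hwd v).mul_right
  have h2 : ∀ v, Integrable fun x => w x * fderiv ℝ (fun y => fderiv ℝ φ y v) x v := fun v =>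
    (hw.continuous.mul (hgd v)).integrable_of_hasCompactSupport hcw.mul_right
  have h3 : ∀ v, Integrable fun x => w x * fderiv ℝ φ x v := fun v =>
    (hw.continuous.mul (hg v).continuous).integrable_of_hasCompactSupport hcw.mul_right
  rw [integral_finsetSum _ fun i _ => h1 _]
  have h4 : ∀ x, -lapl φ x * w x = ∑ i : Fin N, -(w x * fderiv ℝ
      (fun y => fderiv ℝ φ y (EuclideanSpace.single i (1 : ℝ))) x
      (EuclideanSpace.single i (1 : ℝ))) := fun x => by
    rw [Finset.sum_neg_distrib, ← Finset.mul_sum, lapl]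
    ring
  simp_rw [h4]
  rw [integral_finsetSum _ fun i _ => by exact (h2 _).neg]
  refine Finset.sum_congr rfl fun i _ => ?_
  rw [integral_neg, integral_mul_fderiv_eq_neg_fderiv_mul_of_integrable (h1 _) (h2 _) (h3 _)
    (fun x _ => (hw.differentiable (by norm_num)) x)
    (fun x _ => ((hg _).differentiable (by norm_num)) x), neg_neg]

/-- Truncated positive parts of functions vanishing on the boundary, extended by zero. -/
theorem contDiff_indicator_comp {E : Type*} [NormedAddCommGroup E] [NormedSpace ℝ E]
    [ProperSpace E] {Ω : Set E} (ho : IsOpen Ω) (hb : Bornology.IsBounded Ω) {φ : E → ℝ}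
    (hφ : ContDiff ℝ 1 φ) (hφ0 : ∀ x ∈ frontier Ω, φ x = 0) {η : ℝ → ℝ} (hη : ContDiff ℝ 1 η)
    {δ : ℝ} (hδ : 0 < δ) (hη0 : ∀ s ≤ δ, η s = 0) :
    ContDiff ℝ 1 (Ω.indicator fun x => η (φ x)) ∧
      HasCompactSupport (Ω.indicator fun x => η (φ x)) ∧
      tsupport (Ω.indicator fun x => η (φ x)) ⊆ Ω := by
  have hK : IsClosed (closure Ω ∩ {x | δ ≤ φ x}) :=
    isClosed_closure.inter (isClosed_le continuous_const hφ.continuous)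
  have hsupp : tsupport (Ω.indicator fun x => η (φ x)) ⊆ closure Ω ∩ {x | δ ≤ φ x} := by
    refine closure_minimal (fun x hx => ?_) hK
    rw [Function.mem_support] at hx
    have hxΩ : x ∈ Ω := Set.mem_of_indicator_ne_zero hx
    rw [Set.indicator_of_mem hxΩ] at hx
    refine ⟨subset_closure hxΩ, ?_⟩
    by_contra h
    exact hx (hη0 _ (not_le.1 h).le)
  have hKΩ : closure Ω ∩ {x | δ ≤ φ x} ⊆ Ω := by
    rintro x ⟨hx, hxδ⟩
    by_contra hxΩ
    have : φ x = 0 := hφ0 x (by rw [ho.frontier_eq]; exact ⟨hx, hxΩ⟩)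
    have h' : δ ≤ φ x := hxδ
    linarith
  refine ⟨contDiff_iff_contDiffAt.2 fun x => ?_,
    (hb.isCompact_closure.of_isClosed_subset hK Set.inter_subset_left).of_isClosed_subset
      (isClosed_tsupport _) hsupp, hsupp.trans hKΩ⟩
  by_cases hx : x ∈ Ω
  · refine (hη.comp hφ).contDiffAt.congr_of_eventuallyEq ?_
    filter_upwards [ho.mem_nhds hx] with y hy
    simp [Set.indicator_of_mem hy]
  · refine (contDiffAt_const (c := (0 : ℝ))).congr_of_eventuallyEq ?_
    exact notMem_tsupport_iff_eventuallyEq.1 fun h => hx (hKΩ (hsupp h))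

theorem mul_integral_cutoff_le {N : ℕ} {Ω : Set (EuclideanSpace ℝ (Fin N))} (ho : IsOpen Ω)
    (hb : Bornology.IsBounded Ω) {K t : ℝ}
    (hK : ∀ w : EuclideanSpace ℝ (Fin N) → ℝ, ContDiff ℝ 1 w → HasCompactSupport w →
      tsupport w ⊆ Ω →
      K * (∫ x in Ω, |w x| ^ t) ^ (2 / t) ≤ ∫ x in Ω, ‖gradient w x‖ ^ 2)
    {φ : EuclideanSpace ℝ (Fin N) → ℝ} (hφ : ContDiff ℝ 2 φ) (hφ0 : ∀ x ∈ frontier Ω, φ x = 0)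
    {η : ℝ → ℝ} (hη : ContDiff ℝ 1 η) (hη' : ∀ s, 0 ≤ deriv η s ∧ deriv η s ≤ 1)
    {δ : ℝ} (hδ : 0 < δ) (hη0 : ∀ s ≤ δ, η s = 0) :
    K * (∫ x in Ω, |η (φ x)| ^ t) ^ (2 / t) ≤ ∫ x in Ω, -lapl φ x * η (φ x) := by
  obtain ⟨hw, hcw, hwΩ⟩ := contDiff_indicator_comp ho hb (hφ.of_le (by norm_num)) hφ0 hη hδ hη0
  set w := Ω.indicator fun x => η (φ x) with hwdef
  have hwx : ∀ x ∈ Ω, w x = η (φ x) := fun x hx => Set.indicator_of_mem hx _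
  have hfw : ∀ x ∈ Ω, ∀ v, fderiv ℝ w x v = deriv η (φ x) * fderiv ℝ φ x v := fun x hx v => by
    have he : w =ᶠ[nhds x] η ∘ φ := by
      filter_upwards [ho.mem_nhds hx] with y hy
      exact hwx y hy
    have hd := ((hη.differentiable (by norm_num) (φ x)).hasDerivAt.comp_hasFDerivAt x
      (hφ.differentiable (by norm_num) x).hasFDerivAt)
    rw [he.fderiv_eq, hd.fderiv]
    simp
  have h1 : ∫ x in Ω, |η (φ x)| ^ t = ∫ x in Ω, |w x| ^ t :=
    setIntegral_congr_fun ho.measurableSet fun x hx => by simp only [hwx x hx]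
  have h2 : ∫ x in Ω, -lapl φ x * η (φ x) = ∫ x, -lapl φ x * w x := by
    rw [← setIntegral_eq_integral_of_forall_compl_eq_zero (s := Ω)
      (f := fun x => -lapl φ x * w x) fun x hx => by simp [hwdef, hx]]
    exact setIntegral_congr_fun ho.measurableSet fun x hx => by simp only [hwx x hx]
  rw [h1, h2, ← integral_sum_fderiv_mul_fderiv hw hcw hφ]
  refine (hK w hw hcw hwΩ).trans ?_
  rw [← setIntegral_eq_integral_of_forall_compl_eq_zero (s := Ω) (f := fun x =>
    ∑ i, fderiv ℝ w x (EuclideanSpace.single i (1 : ℝ))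
        * fderiv ℝ φ x (EuclideanSpace.single i (1 : ℝ)))]
  · simp_rw [sum_fderiv_single_sq]
    have hwc : ∀ v, Continuous fun x => fderiv ℝ w x v := fun v =>
      (hw.continuous_fderiv (by norm_num)).clm_apply continuous_const
    have hφc : ∀ v, Continuous fun x => fderiv ℝ φ x v := fun v =>
      (hφ.continuous_fderiv (by norm_num)).clm_apply continuous_const
    refine setIntegral_mono_on
      (Continuous.integrableOn_of_isBounded (continuous_finsetSum _ fun i _ => (hwc _).pow 2) hb)
      (Continuous.integrableOn_of_isBounded
        (continuous_finsetSum _ fun i _ => (hwc _).mul (hφc _)) hb)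
      ho.measurableSet fun x hx => Finset.sum_le_sum fun i _ => ?_
    rw [hfw x hx]
    have h := hη' (φ x)
    have : deriv η (φ x) * deriv η (φ x) ≤ deriv η (φ x) := by nlinarith
    nlinarith [mul_le_mul_of_nonneg_right this
      (sq_nonneg (fderiv ℝ φ x (EuclideanSpace.single i (1 : ℝ))))]
  · intro x hx
    have : fderiv ℝ w x = 0 := image_eq_zero_of_notMem_tsupport
      fun h => hx (hwΩ (tsupport_fderiv_subset ℝ h))
    simp [this]

/-- A Sobolev-type inequality for `C¹` functions supported in `Ω` applies to the positive part of a
`C²` function vanishing on the boundary, whose Dirichlet energy is `∫ (-Δφ) φ⁺`. -/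
theorem mul_integral_posPart_le {N : ℕ} {Ω : Set (EuclideanSpace ℝ (Fin N))} (ho : IsOpen Ω)
    (hb : Bornology.IsBounded Ω) (hvol : volume Ω = 1) {K t : ℝ} (ht : 0 < t)
    (hK : ∀ w : EuclideanSpace ℝ (Fin N) → ℝ, ContDiff ℝ 1 w → HasCompactSupport w →
      tsupport w ⊆ Ω →
      K * (∫ x in Ω, |w x| ^ t) ^ (2 / t) ≤ ∫ x in Ω, ‖gradient w x‖ ^ 2)
    {φ : EuclideanSpace ℝ (Fin N) → ℝ} (hφ : ContDiff ℝ 2 φ) (hφ0 : ∀ x ∈ frontier Ω, φ x = 0) :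
    K * (∫ x in Ω, (max (φ x) 0) ^ t) ^ (2 / t) ≤ ∫ x in Ω, -lapl φ x * max (φ x) 0 := by
  have : IsProbabilityMeasure (volume.restrict Ω) := ⟨by simp [hvol]⟩
  have hδ : ∀ n : ℕ, 0 < 1 / ((n : ℝ) + 1) := fun n => by positivity
  have hδ1 : ∀ n : ℕ, 1 / ((n : ℝ) + 1) ≤ 1 := fun n => by
    rw [div_le_one (by positivity)]
    linarith [Nat.cast_nonneg (α := ℝ) n]
  choose η hη hη' hη0 hηδ using fun n => exists_posPart_cutoff (hδ n)
  have hlim : ∀ s, Filter.Tendsto (fun n => η n s) Filter.atTop (nhds (max s 0)) := fun s => by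
    rw [tendsto_iff_dist_tendsto_zero]
    refine squeeze_zero (fun _ => dist_nonneg) (fun n => hηδ n s) ?_
    simpa using (tendsto_one_div_add_atTop_nhds_zero_nat (𝕜 := ℝ)).const_mul 2
  obtain ⟨C, hC0, hC⟩ := hφ.continuous.exists_abs_le_of_isBounded hb
  obtain ⟨L, hL0, hL⟩ := (continuous_lapl hφ).exists_abs_le_of_isBounded hb
  have hηC : ∀ n, ∀ x ∈ Ω, |η n (φ x)| ≤ C + 2 := fun n x hx => by
    have h1 := hηδ n (φ x)
    have h2 := abs_sub_abs_le_abs_sub (η n (φ x)) (max (φ x) 0)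
    have h3 : |max (φ x) 0| ≤ C := by
      rw [abs_of_nonneg (le_max_right _ _)]
      exact max_le ((le_abs_self _).trans (hC x hx)) hC0
    linarith [hδ1 n]
  have hηφ : ∀ n, Continuous fun x => η n (φ x) := fun n => (hη n).continuous.comp hφ.continuous
  have hI := tendsto_integral_abs_rpow_of_bounded (μ := volume.restrict Ω)
    (h := fun x => max (φ x) 0) (u := fun n x => η n (φ x)) (C := C + 2)
    (fun n => (hηφ n).aestronglyMeasurable)
    (fun n => (ae_restrict_iff' ho.measurableSet).2 (.of_forall fun x hx => hηC n x hx))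
    (.of_forall fun x => hlim (φ x)) ht.le
  simp_rw [abs_of_nonneg (le_max_right _ (0 : ℝ))] at hI
  have hR : Filter.Tendsto (fun n => ∫ x in Ω, -lapl φ x * η n (φ x)) Filter.atTop
      (nhds (∫ x in Ω, -lapl φ x * max (φ x) 0)) := by
    refine tendsto_integral_of_dominated_convergence (fun _ => L * (C + 2))
      (fun n => ((continuous_lapl hφ).neg.mul (hηφ n)).aestronglyMeasurable)
      (integrable_const _) (fun n => ?_) (.of_forall fun x => (hlim (φ x)).const_mul _)
    refine (ae_restrict_iff' ho.measurableSet).2 (.of_forall fun x hx => ?_)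
    rw [Real.norm_eq_abs, abs_mul, abs_neg]
    exact mul_le_mul (hL x hx) (hηC n x hx) (abs_nonneg _) hL0
  have hpow := (((Real.continuous_rpow_const (q := 2 / t) (by positivity)).tendsto _).comp
    hI).const_mul K
  exact le_of_tendsto_of_tendsto' hpow hR fun n =>
    mul_integral_cutoff_le ho hb hK hφ hφ0 (hη n) (hη' n) (hδ n) (hη0 n)

theorem exists_eps_le_of_le_rpow_add_rpow {p ε' : ℝ} (hp : 1 < p) (h0 : 0 < ε') (h1 : ε' < 1) :
    ∃ ε : ℝ, 0 < ε ∧ ε ≤ ε' ∧ ∀ a b : ℝ, 0 ≤ b → b ≤ a → 0 < a + b →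
      a + b ≤ (1 + ε) * (a ^ p + b ^ p) ^ (1 / p) → b ≤ ε' * (a + b) := by
  have hc : (1 - ε') ^ (p - 1) < 1 := Real.rpow_lt_one (by linarith) (by linarith) (by linarith)
  have hcont : ContinuousAt (fun e : ℝ => (1 + e) ^ p * (1 - ε') ^ (p - 1)) 0 := by
    refine ContinuousAt.mul (ContinuousAt.rpow_const (by fun_prop) (by simp)) continuousAt_const
  have hev : ∀ᶠ e in nhds (0 : ℝ), (1 + e) ^ p * (1 - ε') ^ (p - 1) < 1 :=
    hcont.eventually_lt_const (by simpa using hc)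
  obtain ⟨d, hd, hball⟩ := Metric.eventually_nhds_iff.1 hev
  have hm : 0 < min (d / 2) ε' := by positivity
  refine ⟨min (d / 2) ε', hm, min_le_right _ _, fun a b hb hba hT hle => ?_⟩
  set ε := min (d / 2) ε'
  have hε : (1 + ε) ^ p * (1 - ε') ^ (p - 1) < 1 := by
    refine hball ?_
    rw [Real.dist_eq, sub_zero, abs_of_pos hm]
    exact (min_le_left _ _).trans_lt (half_lt_self hd)
  by_contra! hlt
  have ha : 0 ≤ a := hb.trans hba
  have haT : a ≤ (1 - ε') * (a + b) := by linarith
  have key : a ^ p + b ^ p ≤ (1 - ε') ^ (p - 1) * (a + b) ^ p := by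
    have e : ∀ x : ℝ, 0 ≤ x → x ^ p = x ^ (p - 1) * x := fun x hx => by
      rw [← Real.rpow_add_one' hx (by linarith)]
      ring_nf
    calc a ^ p + b ^ p = a ^ (p - 1) * a + b ^ (p - 1) * b := by rw [e a ha, e b hb]
      _ ≤ a ^ (p - 1) * a + a ^ (p - 1) * b := by
          gcongr
      _ = a ^ (p - 1) * (a + b) := by ring
      _ ≤ ((1 - ε') * (a + b)) ^ (p - 1) * (a + b) := by
          gcongr
      _ = (1 - ε') ^ (p - 1) * (a + b) ^ p := by
          rw [Real.mul_rpow (by linarith) hT.le, e _ hT.le]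
          ring
  have h2 : (a + b) ^ p ≤ (1 + ε) ^ p * (a ^ p + b ^ p) := by
    have := Real.rpow_le_rpow hT.le hle (by linarith : 0 ≤ p)
    rwa [Real.mul_rpow (by positivity) (by positivity), ← Real.rpow_mul (by positivity),
      one_div_mul_cancel (by linarith), Real.rpow_one] at this
  have hTp : 0 < (a + b) ^ p := by positivity
  have h3 : (1 + ε) ^ p * (a ^ p + b ^ p)
      ≤ (1 + ε) ^ p * (1 - ε') ^ (p - 1) * (a + b) ^ p := by
    rw [mul_assoc]
    gcongr
  nlinarith

theorem sq_le_mul_add_rpow {P κ r : ℝ} (hP : 0 ≤ P) (hκ : 0 < κ) (hr : 2 < r) :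
    P ^ 2 ≤ κ * P + κ ^ (2 - r) * P ^ r := by
  rcases le_total P κ with h | h
  · have : 0 ≤ κ ^ (2 - r) * P ^ r := by positivity
    nlinarith
  · have hP' : 0 < P := hκ.trans_le h
    have h1 : P ^ r = P ^ (r - 2) * P ^ 2 := by
      rw [← Real.rpow_natCast P 2, ← Real.rpow_add hP']
      norm_num
    have h2 : 1 ≤ κ ^ (2 - r) * P ^ (r - 2) := by
      have := Real.rpow_le_rpow hκ.le h (by linarith : 0 ≤ r - 2)
      rw [show 2 - r = -(r - 2) by ring, Real.rpow_neg hκ.le, ← div_eq_inv_mul,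
        one_le_div (by positivity)]
      exact this
    rw [h1, ← mul_assoc]
    nlinarith [mul_nonneg hκ.le hP, sq_nonneg P]

theorem false_of_dominant_estimates {a b c m A B X Y R M k r ε ε' L S p : ℝ} (hL : 0 < L)
    (hS : 0 < S) (hk : 0 < k) (hr : 2 < r) (hε : 0 < ε) (hεε' : ε ≤ ε') (hε'8 : ε' ≤ 1 / 8)
    (hkε' : 2 * k * √ε' ≤ 1 / 4) (hkr : k ^ (2 - r) * (2 * L / S) ^ (r / 2) ≤ 1 / 4)
    (hp : 1 < p) (hM : M ≤ (1 + ε) * L) (hM0 : 0 < M)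
    (hsel : a + b ≤ (1 + ε) * (a ^ p + b ^ p) ^ (1 / p) → b ≤ ε' * (a + b))
    (ha : 0 ≤ a) (hb : 0 ≤ b) (hT : 0 < a + b) (hm0 : 0 ≤ m) (hm : m ≤ 1)
    (hc : c * m = A - B) (hB : B ^ 2 ≤ Y) (hYb : Y ≤ b)
    (hXY : X + Y ≤ (a ^ p + b ^ p) ^ (1 / p))
    (hD : L * (a + b) ≤ M * (X + Y - c ^ 2 * m))
    {Z : ℝ} (hZ0 : 0 ≤ Z) (hZ : S * Z ≤ M * (X + Y - c ^ 2 * m))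
    (hR : R ≤ Z ^ (r / 2))
    (hX : ∀ κ : ℝ, 0 < κ → X ≤ κ * A + κ ^ (2 - r) * R) : False := by
  set T := a + b with hTdef
  have hε1 : ε ≤ 1 := by linarith
  have hpow : (a ^ p + b ^ p) ^ (1 / p) ≤ T := by
    have h1 : a ^ p + b ^ p ≤ T ^ p := Real.add_rpow_le_rpow_add ha hb hp.le
    have := Real.rpow_le_rpow (by positivity) h1 (by positivity : 0 ≤ 1 / p)
    rwa [← Real.rpow_mul hT.le, mul_one_div_cancel (by linarith), Real.rpow_one] at this
  have hcm : 0 ≤ c ^ 2 * m := by positivity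
  set G := X + Y - c ^ 2 * m with hG
  have hG0 : 0 ≤ G := by
    by_contra! h
    have : M * G < 0 := mul_neg_of_pos_of_neg hM0 h
    nlinarith [mul_pos hL hT]
  have hTG : T ≤ (1 + ε) * G := by
    have : L * T ≤ L * ((1 + ε) * G) := by linarith [mul_le_mul_of_nonneg_right hM hG0]
    exact le_of_mul_le_mul_left this hL
  have hbε : b ≤ ε' * T := hsel (hTG.trans (mul_le_mul_of_nonneg_left (by linarith) (by linarith)))
  have hGT : G ≤ T - c ^ 2 * m := by linarith
  have hεT : ε * T ≤ ε' * T := mul_le_mul_of_nonneg_right hεε' hT.le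
  have hε'T : ε' * T ≤ 1 / 8 * T := mul_le_mul_of_nonneg_right hε'8 hT.le
  have hcmε : c ^ 2 * m ≤ ε' * T := by
    have h1 := mul_le_mul_of_nonneg_left hGT (by linarith : 0 ≤ 1 + ε)
    linarith [mul_nonneg hε.le hcm]
  have hXlow : 1 / 2 * T < X := by
    have h1 := mul_le_mul_of_nonneg_right (by linarith : 1 + ε ≤ 9 / 8) hG0
    linarith
  have hε'0 : 0 < ε' := hε.trans_le hεε'
  have hs : √(ε' * T) = √ε' * √T := Real.sqrt_mul hε'0.le _
  have hB' : B ≤ √ε' * √T := by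
    rw [← hs]
    exact Real.le_sqrt_of_sq_le (by linarith)
  have hAB : A - B ≤ √ε' * √T := by
    rw [← hs, ← hc]
    refine Real.le_sqrt_of_sq_le ?_
    linarith [mul_le_mul_of_nonneg_left hm hcm, show (c * m) ^ 2 = c ^ 2 * m * m by ring]
  have hsT : √T * √T = T := Real.mul_self_sqrt hT.le
  have hsT0 : 0 < √T := Real.sqrt_pos.2 hT
  have hZT : Z ≤ 2 * L / S * T := by
    rw [div_mul_eq_mul_div, le_div_iff₀ hS]
    have h1 : M * G ≤ (1 + ε) * L * T := mul_le_mul hM (by linarith) hG0 (by positivity)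
    have h2 := mul_le_mul_of_nonneg_right (by linarith : 1 + ε ≤ 2) (mul_pos hL hT).le
    linarith
  have hκ : 0 < k * √T := by positivity
  have hR' : (k * √T) ^ (2 - r) * R ≤ 1 / 4 * T := by
    calc (k * √T) ^ (2 - r) * R ≤ (k * √T) ^ (2 - r) * (2 * L / S * T) ^ (r / 2) := by
          gcongr
          exact hR.trans (Real.rpow_le_rpow hZ0 hZT (by linarith))
      _ = k ^ (2 - r) * (2 * L / S) ^ (r / 2) * T := by
          rw [Real.mul_rpow hk.le hsT0.le, Real.mul_rpow (by positivity) hT.le, Real.sqrt_eq_rpow,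
            ← Real.rpow_mul hT.le]
          have : T ^ (1 / 2 * (2 - r)) * T ^ (r / 2) = T := by
            rw [← Real.rpow_add hT]
            ring_nf
            exact Real.rpow_one T
          linear_combination (k ^ (2 - r) * (2 * L / S) ^ (r / 2)) * this
      _ ≤ 1 / 4 * T := by gcongr
  have hA : k * √T * A ≤ 1 / 4 * T := by
    calc k * √T * A ≤ k * √T * (2 * (√ε' * √T)) := by
          gcongr
          linarith
      _ = 2 * k * √ε' * T := by linear_combination (2 * k * √ε') * hsT
      _ ≤ 1 / 4 * T := by gcongr
  linarith [hX _ hκ]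

/-- Hölder's inequality against a weight of unit `L^(p/(p-1))` norm. -/
theorem integral_weight_mul_le {N : ℕ} {Ω : Set (EuclideanSpace ℝ (Fin N))} (ho : IsOpen Ω)
    (hb : Bornology.IsBounded Ω) {p : ℝ} (hp : 1 < p) {V g : EuclideanSpace ℝ (Fin N) → ℝ}
    (hV : Continuous V) (hV0 : ∀ x, 0 ≤ V x) (hV1 : ∫ x in Ω, V x ^ (p / (p - 1)) = 1)
    (hg : Continuous g) (hg0 : ∀ x, 0 ≤ g x) :
    ∫ x in Ω, V x * g x ≤ (∫ x in Ω, g x ^ p) ^ (1 / p) := by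
  have : IsFiniteMeasure (volume.restrict Ω) := ⟨by simpa using hb.measure_lt_top⟩
  have hmem : ∀ f : EuclideanSpace ℝ (Fin N) → ℝ, Continuous f → ∀ s : ℝ≥0∞,
      MemLp f s (volume.restrict Ω) := fun f hf s => by
    obtain ⟨C, -, hC⟩ := hf.exists_abs_le_of_isBounded hb
    exact MemLp.of_bound hf.aestronglyMeasurable C
      ((ae_restrict_iff' ho.measurableSet).2 (.of_forall fun x hx => hC x hx))
  have h := integral_mul_le_Lp_mul_Lq_of_nonneg
    (Real.HolderConjugate.conjExponent hp).symm (μ := volume.restrict Ω) (f := V) (g := g)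
    (.of_forall hV0) (.of_forall hg0) (hmem V hV _) (hmem g hg _)
  rwa [Real.conjExponent, hV1, Real.one_rpow, one_mul] at h

/-- There is no nontrivial solution `φ` of `-Δφ = M V (φ - ⟨φ⟩)` with `M ≤ (1 + ε) L` whose positive
part dominates its negative part in `L^(2p)`, for suitably small `ε`. -/
theorem false_of_dominant_posPart {N : ℕ} {Ω : Set (EuclideanSpace ℝ (Fin N))} (ho : IsOpen Ω)
    (hb : Bornology.IsBounded Ω) (hvol : volume Ω = 1) {p k r ε ε' L S : ℝ} (hp : 1 < p)
    (hL : 0 < L) (hS : 0 < S) (hk : 0 < k) (hr : 2 < r) (hε : 0 < ε) (hεε' : ε ≤ ε')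
    (hε'8 : ε' ≤ 1 / 8) (hkε' : 2 * k * √ε' ≤ 1 / 4)
    (hkr : k ^ (2 - r) * (2 * L / S) ^ (r / 2) ≤ 1 / 4)
    (hsel : ∀ a b : ℝ, 0 ≤ b → b ≤ a → 0 < a + b →
      a + b ≤ (1 + ε) * (a ^ p + b ^ p) ^ (1 / p) → b ≤ ε' * (a + b))
    (hLw : ∀ w : EuclideanSpace ℝ (Fin N) → ℝ, ContDiff ℝ 1 w → HasCompactSupport w →
      tsupport w ⊆ Ω →
      L * (∫ x in Ω, |w x| ^ (2 * p)) ^ (2 / (2 * p)) ≤ ∫ x in Ω, ‖gradient w x‖ ^ 2)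
    (hSw : ∀ w : EuclideanSpace ℝ (Fin N) → ℝ, ContDiff ℝ 1 w → HasCompactSupport w →
      tsupport w ⊆ Ω →
      S * (∫ x in Ω, |w x| ^ (r * p)) ^ (2 / (r * p)) ≤ ∫ x in Ω, ‖gradient w x‖ ^ 2)
    {V φ : EuclideanSpace ℝ (Fin N) → ℝ} (hV : Continuous V) (hV0 : ∀ x, 0 ≤ V x)
    (hV1 : ∫ x in Ω, V x ^ (p / (p - 1)) = 1) (hφ : ContDiff ℝ 2 φ)
    (hφ0 : ∀ x ∈ frontier Ω, φ x = 0) {x₀ : EuclideanSpace ℝ (Fin N)} (hx₀ : x₀ ∈ Ω)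
    (hφx₀ : φ x₀ ≠ 0) {M c : ℝ} (hc : c * ∫ x in Ω, V x = ∫ x in Ω, V x * φ x)
    (heq : ∀ x ∈ Ω, -lapl φ x = M * (V x * (φ x - c))) (hM : M ≤ (1 + ε) * L)
    (hba : ∫ x in Ω, (max (-φ x) 0) ^ (2 * p) ≤ ∫ x in Ω, (max (φ x) 0) ^ (2 * p)) : False := by
  have : IsProbabilityMeasure (volume.restrict Ω) := ⟨by simp [hvol]⟩
  have hr0 : 0 < r := by linarith
  have hp0 : 0 < p := by linarith
  have hi : ∀ {f : EuclideanSpace ℝ (Fin N) → ℝ}, Continuous f → IntegrableOn f Ω volume :=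
    fun hf => hf.integrableOn_of_isBounded hb
  have hφc := hφ.continuous
  set P : EuclideanSpace ℝ (Fin N) → ℝ := fun x => max (φ x) 0 with hPdef
  set Q : EuclideanSpace ℝ (Fin N) → ℝ := fun x => max (-φ x) 0 with hQdef
  have hPc : Continuous P := hφc.max continuous_const
  have hQc : Continuous Q := hφc.neg.max continuous_const
  have hP0 : ∀ x, 0 ≤ P x := fun x => le_max_right _ _
  have hQ0 : ∀ x, 0 ≤ Q x := fun x => le_max_right _ _
  have hPQ : ∀ x, φ x = P x - Q x ∧ P x * Q x = 0 := fun x => by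
    rcases le_total (φ x) 0 with h | h
    · simp [hPdef, hQdef, h]
    · simp [hPdef, hQdef, h]
  have hpc : ∀ {f : EuclideanSpace ℝ (Fin N) → ℝ} {s : ℝ}, Continuous f → 0 ≤ s →
      Continuous fun x => f x ^ s := fun hf hs => hf.rpow_const fun x => .inr hs
  have hhol : ∀ g : EuclideanSpace ℝ (Fin N) → ℝ, Continuous g → (∀ x, 0 ≤ g x) →
      ∫ x in Ω, V x * g x ≤ (∫ x in Ω, g x ^ p) ^ (1 / p) := fun g hg hg0 =>
    integral_weight_mul_le ho hb hp hV hV0 hV1 hg hg0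
  have hnn : ∀ {f : EuclideanSpace ℝ (Fin N) → ℝ}, (∀ x, 0 ≤ f x) → 0 ≤ ∫ x in Ω, f x :=
    fun hf => integral_nonneg hf
  have hsq : ∀ y : ℝ, 0 ≤ y → (y ^ 2) ^ p = y ^ (2 * p) := fun y hy => by
    rw [← Real.rpow_natCast, ← Real.rpow_mul hy]; norm_num
  have hexp : 2 / (2 * p) = 1 / p := by field_simp
  set IP := ∫ x in Ω, P x ^ (2 * p) with hIP
  set IQ := ∫ x in Ω, Q x ^ (2 * p) with hIQ
  have hIP0 : 0 ≤ IP := hnn fun x => Real.rpow_nonneg (hP0 x) _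
  have hIQ0 : 0 ≤ IQ := hnn fun x => Real.rpow_nonneg (hQ0 x) _
  have hap : (IP ^ (1 / p)) ^ p = IP := by
    rw [← Real.rpow_mul hIP0, one_div_mul_cancel hp0.ne', Real.rpow_one]
  have hbp : (IQ ^ (1 / p)) ^ p = IQ := by
    rw [← Real.rpow_mul hIQ0, one_div_mul_cancel hp0.ne', Real.rpow_one]
  have hsum : IP + IQ = ∫ x in Ω, (P x ^ 2 + Q x ^ 2) ^ p := by
    rw [hIP, hIQ, ← integral_add (hi (hpc hPc (by positivity))) (hi (hpc hQc (by positivity)))]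
    refine integral_congr_ae (.of_forall fun x => ?_)
    have h2p : (2 * p) ≠ 0 := by positivity
    rcases mul_eq_zero.1 (hPQ x).2 with h | h <;>
      simp [h, hsq _ (hP0 x), hsq _ (hQ0 x), Real.zero_rpow h2p]
  have hpos : 0 < IP + IQ := by
    rw [hsum]
    have hcont : Continuous fun x => (P x ^ 2 + Q x ^ 2) ^ p :=
      hpc ((hPc.pow 2).add (hQc.pow 2)) hp0.le
    rw [setIntegral_pos_iff_support_of_nonneg_ae (.of_forall fun x => by positivity) (hi hcont)]
    refine (IsOpen.inter (hcont.isOpen_support) ho).measure_pos volume ⟨x₀, ?_, hx₀⟩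
    refine (Real.rpow_pos_of_pos ?_ _).ne'
    have h1 : 0 < φ x₀ ^ 2 := by positivity
    have h2 := hPQ x₀
    have h3 : φ x₀ ^ 2 = P x₀ ^ 2 + Q x₀ ^ 2 := by rw [h2.1]; linear_combination (-2) * h2.2
    linarith
  have hm1 : ∫ x in Ω, V x ≤ 1 := by
    have := hhol (fun _ => 1) continuous_const fun _ => zero_le_one
    simpa using this
  have hVP : Continuous fun x => V x * P x := hV.mul hPc
  have hVQ : Continuous fun x => V x * Q x := hV.mul hQc
  have hVP2 : Continuous fun x => V x * P x ^ 2 := hV.mul (hPc.pow 2)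
  have hVQ2 : Continuous fun x => V x * Q x ^ 2 := hV.mul (hQc.pow 2)
  set m := ∫ x in Ω, V x with hm
  set A := ∫ x in Ω, V x * P x with hA
  set B := ∫ x in Ω, V x * Q x with hB
  set X := ∫ x in Ω, V x * P x ^ 2 with hX
  set Y := ∫ x in Ω, V x * Q x ^ 2 with hY
  have hm0 : 0 ≤ m := hnn hV0
  have hcAB : c * m = A - B := by
    rw [hc, hA, hB, ← integral_sub (hi hVP) (hi hVQ)]
    refine integral_congr_ae (.of_forall fun x => ?_)
    simp only [(hPQ x).1]
    ring
  have hYb : Y ≤ IQ ^ (1 / p) := by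
    have := hhol (fun x => Q x ^ 2) (hQc.pow 2) fun x => sq_nonneg _
    simpa only [hsq _ (hQ0 _)] using this
  have hXY : X + Y ≤ ((IP ^ (1 / p)) ^ p + (IQ ^ (1 / p)) ^ p) ^ (1 / p) := by
    rw [hap, hbp, hsum, hX, hY, ← integral_add (hi hVP2) (hi hVQ2)]
    have := hhol (fun x => P x ^ 2 + Q x ^ 2) ((hPc.pow 2).add (hQc.pow 2)) fun x => by positivity
    simpa only [mul_add] using this
  have hBY : B ^ 2 ≤ Y := by
    have h1 : 0 ≤ ∫ x in Ω, V x * (Q x - B) ^ 2 := hnn fun x => mul_nonneg (hV0 x) (sq_nonneg _)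
    have h2 : ∫ x in Ω, V x * (Q x - B) ^ 2 = Y - 2 * B * B + B ^ 2 * m := by
      rw [hY, hm, ← integral_const_mul (B ^ 2), show 2 * B * B = ∫ x in Ω, 2 * B * (V x * Q x) by
        rw [integral_const_mul], ← integral_sub (hi hVQ2) ((hi hVQ).const_mul _),
        ← integral_add (hi (by fun_prop : Continuous fun x => V x * Q x ^ 2 - 2 * B * (V x * Q x)))
          ((hi hV).const_mul _)]
      refine integral_congr_ae (.of_forall fun x => ?_)
      simp only
      ring
    nlinarith [mul_le_mul_of_nonneg_left hm1 (sq_nonneg B)]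
  have hG0 : 0 ≤ X + Y - c ^ 2 * m := by
    have h1 : 0 ≤ ∫ x in Ω, V x * (P x - Q x - c) ^ 2 :=
      hnn fun x => mul_nonneg (hV0 x) (sq_nonneg _)
    have h2 : ∫ x in Ω, V x * (P x - Q x - c) ^ 2 = X + Y - 2 * c * (A - B) + c ^ 2 * m := by
      rw [hX, hY, hA, hB, hm, ← integral_const_mul (c ^ 2), ← integral_sub (hi hVP) (hi hVQ),
        ← integral_const_mul, ← integral_add (hi hVP2) (hi hVQ2),
        ← integral_sub (hi (by fun_prop : Continuous fun x => V x * P x ^ 2 + V x * Q x ^ 2))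
          (hi (by fun_prop : Continuous fun x => 2 * c * (V x * P x - V x * Q x))),
        ← integral_add (hi (by fun_prop : Continuous fun x => V x * P x ^ 2 + V x * Q x ^ 2
          - 2 * c * (V x * P x - V x * Q x))) ((hi hV).const_mul _)]
      refine integral_congr_ae (.of_forall fun x => ?_)
      simp only
      linear_combination (-2 * V x) * (hPQ x).2
    rw [h2, ← hcAB] at h1
    linarith
  have hDP : ∫ x in Ω, -lapl φ x * P x = M * (X - c * A) := by
    rw [hX, hA, ← integral_const_mul c, ← integral_sub (hi hVP2) ((hi hVP).const_mul _),
      ← integral_const_mul]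
    refine setIntegral_congr_fun ho.measurableSet fun x hx => ?_
    simp only [heq x hx, (hPQ x).1]
    linear_combination (-M * V x) * (hPQ x).2
  have hDQ : ∫ x in Ω, -lapl (fun y => -φ y) x * Q x = M * (Y + c * B) := by
    rw [hY, hB, ← integral_const_mul c, ← integral_add (hi hVQ2) ((hi hVQ).const_mul _),
      ← integral_const_mul]
    refine setIntegral_congr_fun ho.measurableSet fun x hx => ?_
    have hneg : -lapl (fun y => -φ y) x = -(M * (V x * (φ x - c))) := by
      rw [← heq x hx]
      simp [lapl, fderiv_fun_neg]
    simp only [hneg, (hPQ x).1]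
    linear_combination (-M * V x) * (hPQ x).2
  have hLP := mul_integral_posPart_le ho hb hvol (by positivity) hLw hφ hφ0
  have hLQ := mul_integral_posPart_le ho hb hvol (by positivity) hLw hφ.neg
    (fun x hx => by simp [hφ0 x hx])
  have hSP := mul_integral_posPart_le ho hb hvol (by positivity) hSw hφ hφ0
  rw [hDP] at hLP hSP
  rw [hDQ] at hLQ
  rw [hexp] at hLP hLQ
  have ha0 : 0 ≤ IP ^ (1 / p) := Real.rpow_nonneg hIP0 _
  have hb0 : 0 ≤ IQ ^ (1 / p) := Real.rpow_nonneg hIQ0 _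
  have hab : IQ ^ (1 / p) ≤ IP ^ (1 / p) := Real.rpow_le_rpow hIQ0 hba (by positivity)
  have hT : 0 < IP ^ (1 / p) + IQ ^ (1 / p) := by
    have : 0 < IP := by linarith
    positivity
  have hsplit : M * (X - c * A) + M * (Y + c * B) = M * (X + Y - c ^ 2 * m) := by
    linear_combination (M * c) * hcAB
  have hD : L * (IP ^ (1 / p) + IQ ^ (1 / p)) ≤ M * (X + Y - c ^ 2 * m) := by
    rw [← hsplit, mul_add]
    exact add_le_add hLP hLQ
  have hM0 : 0 < M := by
    by_contra! h
    linarith [mul_nonpos_of_nonpos_of_nonneg h hG0, mul_pos hL hT]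
  have hR : ∫ x in Ω, V x * P x ^ r ≤ ((∫ x in Ω, P x ^ (r * p)) ^ (2 / (r * p))) ^ (r / 2) := by
    have h := hhol (fun x => P x ^ r) (hpc hPc hr0.le) fun x => Real.rpow_nonneg (hP0 x) _
    simp only [← Real.rpow_mul (hP0 _)] at h
    rw [← Real.rpow_mul (hnn fun x => Real.rpow_nonneg (hP0 x) _)]
    convert h using 2
    field_simp
  refine false_of_dominant_estimates hL hS hk hr hε hεε' hε'8 hkε' hkr hp hM hM0
    (hsel _ _ hb0 hab hT) ha0 hb0 hT hm0 hm1 hcAB hBY hYb hXY hD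
    (Z := (∫ x in Ω, P x ^ (r * p)) ^ (2 / (r * p)))
    (Real.rpow_nonneg (hnn fun x => Real.rpow_nonneg (hP0 x) _) _) ?_ hR fun κ hκ => ?_
  · have : 0 ≤ M * (Y + c * B) := (mul_nonneg hL.le hb0).trans hLQ
    linarith
  · have hVr : Continuous fun x => V x * P x ^ r := hV.mul (hpc hPc hr0.le)
    rw [hX, hA, ← integral_const_mul, ← integral_const_mul,
      ← integral_add ((hi hVP).const_mul _) ((hi hVr).const_mul _)]
    refine integral_mono (hi hVP2) (((hi hVP).const_mul _).add ((hi hVr).const_mul _)) fun x => ?_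
    have := mul_le_mul_of_nonneg_left (sq_le_mul_add_rpow (hP0 x) hκ hr) (hV0 x)
    simp only
    linarith

theorem Lam_pos {N : ℕ} {Ω : Set (EuclideanSpace ℝ (Fin N))} (ho : IsOpen Ω)
    (hne : Ω.Nonempty) (hb : Bornology.IsBounded Ω) {t S : ℝ} (ht : 0 < t) (hS : 0 < S)
    (hSw : ∀ w : EuclideanSpace ℝ (Fin N) → ℝ, ContDiff ℝ 1 w → HasCompactSupport w →
      tsupport w ⊆ Ω →
      S * (∫ x in Ω, |w x| ^ t) ^ (2 / t) ≤ ∫ x in Ω, ‖gradient w x‖ ^ 2) : 0 < Lam Ω t := by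
  refine hS.trans_le (le_csInf ?_ ?_)
  · obtain ⟨x, hx⟩ := hne
    obtain ⟨w, h1, h2, h3, -, h5⟩ :=
      exists_contDiff_tsupport_subset (n := (⊤ : ℕ∞)) (ho.mem_nhds hx)
    exact ⟨_, w, h3, h2, h1, fun h => by simp [h] at h5, rfl⟩
  · rintro _ ⟨w, hw, hcw, hwΩ, hw0, rfl⟩
    have hcont : Continuous fun x => |w x| ^ t :=
      hw.continuous.abs.rpow_const fun _ => .inr ht.le
    have hpos : 0 < ∫ x in Ω, |w x| ^ t := by
      rw [setIntegral_pos_iff_support_of_nonneg_ae (.of_forall fun x => by positivity)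
        (hcont.integrableOn_of_isBounded hb)]
      obtain ⟨x, hx⟩ := Function.ne_iff.1 hw0
      refine (IsOpen.inter (hcont.isOpen_support) ho).measure_pos volume
        ⟨x, ?_, hwΩ (subset_tsupport w hx)⟩
      exact (Real.rpow_pos_of_pos (abs_pos.2 hx) _).ne'
    rw [le_div_iff₀ (by positivity)]
    exact hSw w (hw.of_le (by norm_cast)) hcw hwΩ

theorem exists_subcritical_exponent {N : ℕ} (hN : 2 ≤ N) {p : ℝ} (hp : 1 < p)
    (hpN : N = 2 ∨ p < (N : ℝ) / ((N : ℝ) - 2)) :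
    ∃ r : ℝ, 2 < r ∧ 1 / 2 < 1 / (r * p) + 1 / (N : ℝ) := by
  have h : 1 / 2 < 1 / (2 * p) + 1 / (N : ℝ) := by
    rcases hpN with rfl | h
    · have : 0 < 1 / (2 * p) := by positivity
      push_cast
      linarith
    · have hN' : (2 : ℝ) ≤ N := by exact_mod_cast hN
      have hN2 : (0 : ℝ) < N - 2 := by
        rcases hN'.eq_or_lt with h' | h'
        · rw [← h'] at h
          norm_num at h
          linarith
        · linarith
      rw [lt_div_iff₀ hN2] at h
      rw [div_add_div _ _ (by positivity) (by positivity), div_lt_div_iff₀ (by norm_num)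
        (by positivity)]
      linarith
  have hcont : ContinuousAt (fun r : ℝ => 1 / (r * p) + 1 / (N : ℝ)) 2 := by
    have : (2 : ℝ) * p ≠ 0 := by positivity
    fun_prop (disch := assumption)
  have hev := (hcont.eventually_const_lt h).filter_mono (nhdsWithin_le_nhds (s := Ioi 2))
  exact (hev.and self_mem_nhdsWithin).exists.imp fun r hr => ⟨hr.2, hr.1⟩

theorem exists_pos_rpow_mul_le {r D : ℝ} (hr : 2 < r) :
    ∃ k : ℝ, 0 < k ∧ k ^ (2 - r) * D ≤ 1 / 4 := by
  have h : Filter.Tendsto (fun k : ℝ => k ^ (-(r - 2)) * D) Filter.atTop (nhds (0 * D)) :=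
    (tendsto_rpow_neg_atTop (by linarith)).mul_const D
  rw [zero_mul] at h
  obtain ⟨k, hk, hk0⟩ :=
    ((h.eventually_le_const (by norm_num : (0 : ℝ) < 1 / 4)).and
      (Filter.eventually_gt_atTop 0)).exists
  exact ⟨k, hk0, by simpa using hk⟩

theorem stmt8 (N : ℕ) (hN : 2 ≤ N) (Ω : Set (EuclideanSpace ℝ (Fin N)))
    (hΩ : IsC3Domain Ω) (hvol : volume Ω = 1) (p : ℝ) (hp1 : 1 < p)
    (hpN : N = 2 ∨ p < (N : ℝ) / ((N : ℝ) - 2)) :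
    (∃ lbar : ℝ, Lam Ω (2 * p) / p < lbar ∧
      ∀ lam : ℝ, 0 ≤ lam → lam < lbar →
        ∀ (α : ℝ) (ψ : EuclideanSpace ℝ (Fin N) → ℝ), IsSol Ω p lam α ψ →
          ∀ σ : ℝ, IsEigen Ω p lam α ψ σ → 0 < σ) ∧
    (∀ lam : ℝ, 0 ≤ lam → lam ≤ Lam Ω (2 * p) / p →
      ∀ (α : ℝ) (ψ : EuclideanSpace ℝ (Fin N) → ℝ), IsSol Ω p lam α ψ →
        ∀ σ : ℝ, IsEigen Ω p lam α ψ σ → 0 < σ) := by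
  obtain ⟨ho, hconn, hb, -⟩ := hΩ
  have hp0 : 0 < p := by linarith
  obtain ⟨r, hr, hrN⟩ := exists_subcritical_exponent hN hp1 hpN
  have hr0 : 0 < r := by linarith
  obtain ⟨S, hS, hSw⟩ := exists_sobolev_const hN hb hvol (by positivity) hrN
  obtain ⟨S₂, hS₂, hS₂w⟩ := exists_sobolev_const (q := 2 * p) hN hb hvol (by positivity)
    (hrN.trans_le (by gcongr))
  have hL := Lam_pos ho hconn.nonempty hb (by positivity) hS₂ hS₂w
  have hLw := fun w => Lam_mul_le (w := w) ho hvol (by positivity : 0 < 2 * p)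
  obtain ⟨k, hk, hkr⟩ := exists_pos_rpow_mul_le (D := (2 * Lam Ω (2 * p) / S) ^ (r / 2)) hr
  obtain ⟨ε', hε'0, hε'8, hkε'⟩ : ∃ ε' : ℝ, 0 < ε' ∧ ε' ≤ 1 / 8 ∧ 2 * k * √ε' ≤ 1 / 4 := by
    refine ⟨min (1 / 8) ((1 / (8 * k)) ^ 2), by positivity, min_le_left _ _, ?_⟩
    have : √(min (1 / 8) ((1 / (8 * k)) ^ 2)) ≤ 1 / (8 * k) :=
      (Real.sqrt_le_sqrt (min_le_right _ _)).trans_eq (Real.sqrt_sq (by positivity))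
    calc _ ≤ 2 * k * (1 / (8 * k)) := by gcongr
      _ = 1 / 4 := by field_simp; norm_num
  obtain ⟨ε, hε, hεε', hsel⟩ := exists_eps_le_of_le_rpow_add_rpow hp1 hε'0 (by linarith)
  have hlt : Lam Ω (2 * p) / p < (1 + ε) * Lam Ω (2 * p) / p := by
    gcongr
    linarith [mul_pos hε hL]
  have main : ∀ lam : ℝ, 0 ≤ lam → lam < (1 + ε) * Lam Ω (2 * p) / p →
      ∀ (α : ℝ) (ψ : EuclideanSpace ℝ (Fin N) → ℝ), IsSol Ω p lam α ψ →
        ∀ σ : ℝ, IsEigen Ω p lam α ψ σ → 0 < σ := by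
    rintro lam - hlam α ψ ⟨hψ, -, -, hψ1⟩ σ ⟨φ, hφ, ⟨x₀, hx₀, hφx₀⟩, hφ0, heq⟩
    by_contra! hσ
    rw [lt_div_iff₀ hp0] at hlam
    have hM : p * lam + σ ≤ (1 + ε) * Lam Ω (2 * p) := by linarith
    have hx₀Ω : x₀ ∈ Ω := by
      by_contra h
      exact hφx₀ (hφ0 x₀ (by rw [ho.frontier_eq]; exact ⟨hx₀, h⟩))
    have hV : Continuous (Vfun p lam α ψ) :=
      ((continuous_const.add (continuous_const.mul hψ.continuous)).max
        continuous_const).rpow_const fun _ => .inr (by linarith)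
    have hV0 : ∀ x, 0 ≤ Vfun p lam α ψ x := fun x => Real.rpow_nonneg (le_max_right _ _) _
    have hV1 : ∫ x in Ω, Vfun p lam α ψ x ^ (p / (p - 1)) = 1 := by
      refine (integral_congr_ae (.of_forall fun x => ?_)).trans hψ1
      simp only [Vfun]
      rw [← Real.rpow_mul (le_max_right _ _), mul_div_cancel₀ _ (sub_pos.2 hp1).ne']
    have hm : mV Ω p lam α ψ ≠ 0 := fun h => by
      have hae := (setIntegral_eq_zero_iff_of_nonneg_ae (.of_forall hV0)
        (hV.integrableOn_of_isBounded hb)).1 h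
      have : ∫ x in Ω, Vfun p lam α ψ x ^ (p / (p - 1)) = 0 := by
        refine integral_eq_zero_of_ae (hae.mono fun x hx => ?_)
        have : p / (p - 1) ≠ 0 := (div_pos hp0 (by linarith)).ne'
        simp_all
      linarith
    have hc : avgV Ω p lam α ψ φ * ∫ x in Ω, Vfun p lam α ψ x
        = ∫ x in Ω, Vfun p lam α ψ x * φ x := div_mul_cancel₀ _ hm
    rcases le_total (∫ x in Ω, (max (-φ x) 0) ^ (2 * p)) (∫ x in Ω, (max (φ x) 0) ^ (2 * p))
      with h | h
    · exact false_of_dominant_posPart ho hb hvol hp1 hL hS hk hr hε hεε' hε'8 hkε' hkr hsel hLw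
        hSw hV hV0 hV1 hφ hφ0 hx₀Ω hφx₀ hc heq hM h
    · refine false_of_dominant_posPart ho hb hvol hp1 hL hS hk hr hε hεε' hε'8 hkε' hkr hsel hLw
        hSw hV hV0 hV1 hφ.neg (fun x hx => by simp [hφ0 x hx]) hx₀Ω (neg_ne_zero.2 hφx₀)
        (c := -avgV Ω p lam α ψ φ) ?_ (fun x hx => ?_) hM (by simpa using h)
      · simp only [mul_neg, integral_neg, neg_mul, hc]
      · have : lapl (fun y => -φ y) x = -lapl φ x := by simp [lapl, fderiv_fun_neg]
        rw [this, heq x hx]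
        ring
  exact ⟨⟨_, hlt, main⟩, fun lam h0 h => main lam h0 (h.trans_lt hlt)⟩

end
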